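/- (Theorem 5, joint distribution of the equivalent variation and choices.) Let p, p' : C → ℝ be price vectors, y ∈ ℝ an income, and EV : Ω → ℝ an equivalent variation. Then for all i, j ∈ C and z ∈ ℝ: μ {ω | EV ω ≤ z and i is weakly optimal for ω at (p, y) and j is weakly optimal for ω at (p', y)} equals P_{i,j}(p, min(p + z, p'), y) if p' j ≤ p j + z, and equals 0 otherwise, where min denotes the componentwise minimum and p + z the vector with components p c + z. -/

import Mathlib

open MeasureTheory
open scoped ENNReal BigOperators

/-- `i` is weakly optimal for type `ω` at price vector `p` and income `y`:
its utility is weakly largest among all alternatives. -/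
def WeakOpt {Ω : Type*} {n : ℕ} (U : Ω → Fin n → ℝ → ℝ) (ω : Ω)
    (p : Fin n → ℝ) (y : ℝ) (i : Fin n) : Prop :=
  ∀ c, U ω c (y - p c) ≤ U ω i (y - p i)

/-- Choice probability `P_i(p, y)`. -/
noncomputable def ChoiceProb {Ω : Type*} [MeasurableSpace Ω] {n : ℕ}
    (μ : Measure Ω) (U : Ω → Fin n → ℝ → ℝ) (p : Fin n → ℝ) (y : ℝ) (i : Fin n) : ℝ≥0∞ :=
  μ {ω | WeakOpt U ω p y i}

/-- Transition probability `P_{i,j}(p, p', y)`. -/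
noncomputable def TransProb {Ω : Type*} [MeasurableSpace Ω] {n : ℕ}
    (μ : Measure Ω) (U : Ω → Fin n → ℝ → ℝ) (p p' : Fin n → ℝ) (y : ℝ) (i j : Fin n) : ℝ≥0∞ :=
  μ {ω | WeakOpt U ω p y i ∧ WeakOpt U ω p' y j}

/-- Regularity condition (R1): for every type, every pair of alternatives and every
residual numeraire level, sufficiently poor levels at `c'` are worse and sufficiently
rich levels at `c'` are better. -/
def Reg1 {Ω : Type*} {n : ℕ} (U : Ω → Fin n → ℝ → ℝ) : Prop :=
  ∀ (ω : Ω) (c c' : Fin n) (m : ℝ),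
    (∃ m₀ : ℝ, ∀ m' ≤ m₀, U ω c' m' < U ω c m) ∧
    (∃ m₁ : ℝ, ∀ m', m₁ ≤ m' → U ω c m < U ω c' m')

/-- Negligible ties (R2): at any price vector and income, the set of types indifferent
between two distinct alternatives has measure zero. -/
def Reg2 {Ω : Type*} [MeasurableSpace Ω] {n : ℕ} (μ : Measure Ω)
    (U : Ω → Fin n → ℝ → ℝ) : Prop :=
  ∀ (q : Fin n → ℝ) (y : ℝ) (c c' : Fin n), c ≠ c' →
    μ {ω | U ω c (y - q c) = U ω c' (y - q c')} = 0

/-- A family of nested opportunity sets, described by an index set `Λ ⊆ ℝ`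
and virtual prices `ptilde`. -/
structure NOSFamily {n : ℕ} (Λ : Set ℝ) (ptilde : ℝ → Fin n → ℝ) : Prop where
  nonempty : Λ.Nonempty
  closed : IsClosed Λ
  cont : ∀ c : Fin n, ContinuousOn (fun l => ptilde l c) Λ
  anti : ∀ l ∈ Λ, ∀ l' ∈ Λ, l < l' →
    (∀ c, ptilde l' c ≤ ptilde l c) ∧ ∃ c, ptilde l' c < ptilde l c
  unbddAbove : ∀ (c : Fin n) (M : ℝ), ∃ l ∈ Λ, M ≤ ptilde l c
  unbddBelow : ∃ c : Fin n, ∀ M : ℝ, ∃ l ∈ Λ, ptilde l c ≤ M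

/-- The NOS welfare measure of type `ω` at alternative `k` with price `pk`. -/
noncomputable def NOSWelfare {Ω : Type*} {n : ℕ} (U : Ω → Fin n → ℝ → ℝ)
    (Λ : Set ℝ) (ptilde : ℝ → Fin n → ℝ) (y : ℝ) (k : Fin n) (pk : ℝ) (ω : Ω) : ℝ :=
  sSup {l | l ∈ Λ ∧ ∀ c, U ω c (y - ptilde l c) ≤ U ω k (y - pk)}

/-- The money-metric utility of type `ω` at alternative `k` with price `pk`,
income `y` and reference prices `r`. -/
noncomputable def MMU {Ω : Type*} {n : ℕ} (U : Ω → Fin n → ℝ → ℝ)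
    (r : Fin n → ℝ) (y : ℝ) (k : Fin n) (pk : ℝ) (ω : Ω) : ℝ :=
  sSup {l : ℝ | ∀ c, U ω c (l - r c) ≤ U ω k (y - pk)}

/-- `CV` is a compensating variation for the price change from `p` to `p'` at income `y`. -/
def IsCV {Ω : Type*} {n : ℕ} (U : Ω → Fin n → ℝ → ℝ)
    (p p' : Fin n → ℝ) (y : ℝ) (CV : Ω → ℝ) : Prop :=
  ∀ ω, (⨆ c, U ω c (y - p c)) = ⨆ c, U ω c (y - p' c - CV ω)

/-- `EV` is an equivalent variation for the price change from `p` to `p'` at income `y`. -/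
def IsEV {Ω : Type*} {n : ℕ} (U : Ω → Fin n → ℝ → ℝ)
    (p p' : Fin n → ℝ) (y : ℝ) (EV : Ω → ℝ) : Prop :=
  ∀ ω, (⨆ c, U ω c (y - p c - EV ω)) = ⨆ c, U ω c (y - p' c)

/-- A weakly optimal alternative attains the maximal utility. -/
lemma WeakOpt.iSup_eq {Ω : Type*} {n : ℕ} {U : Ω → Fin n → ℝ → ℝ} {ω : Ω}
    {p : Fin n → ℝ} {y : ℝ} {i : Fin n} (h : WeakOpt U ω p y i) :
    (⨆ c, U ω c (y - p c)) = U ω i (y - p i) :=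
  have : Nonempty (Fin n) := ⟨i⟩
  le_antisymm (ciSup_le h)
    (le_ciSup (f := fun c => U ω c (y - p c)) (Set.finite_range _).bddAbove i)

/-- For a type that weakly prefers `j` at the new prices, the equivalent variation is at most `z`
iff no alternative at the old prices shifted by `z` is better than `j` at the new prices. -/
lemma IsEV.le_iff_of_weakOpt {Ω : Type*} {n : ℕ} {U : Ω → Fin n → ℝ → ℝ}
    (hMono : ∀ ω c, StrictMono (U ω c)) {p p' : Fin n → ℝ} {y : ℝ} {EV : Ω → ℝ}
    (hEV : IsEV U p p' y EV) {ω : Ω} {j : Fin n} (hj : WeakOpt U ω p' y j) (z : ℝ) :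
    EV ω ≤ z ↔ ∀ c, U ω c (y - (p c + z)) ≤ U ω j (y - p' j) := by
  have hsup := (hEV ω).trans hj.iSup_eq
  constructor
  · intro hz c
    calc U ω c (y - (p c + z)) ≤ U ω c (y - p c - EV ω) := (hMono ω c).monotone (by linarith)
      _ ≤ ⨆ c, U ω c (y - p c - EV ω) :=
        le_ciSup (f := fun c => U ω c (y - p c - EV ω)) (Set.finite_range _).bddAbove c
      _ = U ω j (y - p' j) := hsup
  · intro h
    by_contra! hz
    have : Nonempty (Fin n) := ⟨j⟩
    obtain ⟨c, hc⟩ := exists_eq_ciSup_of_finite (f := fun c => U ω c (y - p c - EV ω))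
    have hlt : U ω c (y - p c - EV ω) < U ω c (y - (p c + z)) := hMono ω c (by linarith)
    exact absurd (hc.trans hsup) (hlt.trans_le (h c)).ne

/-- Weak optimality at the componentwise minimum of two price vectors, for an alternative whose
price is the smaller one in the second vector. -/
lemma weakOpt_min_iff {Ω : Type*} {n : ℕ} {U : Ω → Fin n → ℝ → ℝ} {ω : Ω}
    (hMono : ∀ c, StrictMono (U ω c)) {q q' : Fin n → ℝ} {y : ℝ} {j : Fin n}
    (hj : q' j ≤ q j) :
    WeakOpt U ω (fun c => min (q c) (q' c)) y j ↔
      (∀ c, U ω c (y - q c) ≤ U ω j (y - q' j)) ∧ WeakOpt U ω q' y j := by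
  simp only [WeakOpt, min_eq_right hj, ← forall_and]
  refine forall_congr' fun c => ?_
  rw [← max_sub_sub_left, (hMono c).monotone.map_max, max_le_iff]

/-- Theorem 5: joint distribution of the equivalent variation
and the choices before and after the price change. -/
theorem ev_joint_distribution {Ω : Type*} [MeasurableSpace Ω] {n : ℕ} (hn : 0 < n)
    (μ : Measure Ω) [IsProbabilityMeasure μ]
    (U : Ω → Fin n → ℝ → ℝ)
    (hMono : ∀ ω c, StrictMono (U ω c))
    (p p' : Fin n → ℝ) (y : ℝ) (EV : Ω → ℝ) (hEV : IsEV U p p' y EV)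
    (i j : Fin n) (z : ℝ) :
    μ {ω | EV ω ≤ z ∧ WeakOpt U ω p y i ∧ WeakOpt U ω p' y j} =
      if p' j ≤ p j + z
      then TransProb μ U p (fun c => min (p c + z) (p' c)) y i j
      else 0 := by
  have hset : {ω | EV ω ≤ z ∧ WeakOpt U ω p y i ∧ WeakOpt U ω p' y j} =
      {ω | WeakOpt U ω p y i ∧
        (∀ c, U ω c (y - (p c + z)) ≤ U ω j (y - p' j)) ∧ WeakOpt U ω p' y j} := by
    ext ω
    have key := fun hj : WeakOpt U ω p' y j => hEV.le_iff_of_weakOpt hMono hj z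
    simp only [Set.mem_ofPred_eq]
    tauto
  rw [hset]
  split_ifs with h
  · simp only [TransProb, weakOpt_min_iff (hMono _) (q := fun c => p c + z) h]
  · convert measure_empty (μ := μ)
    refine Set.eq_empty_of_forall_notMem fun ω hω => h ?_
    have := (hMono ω j).le_iff_le.mp (hω.2.1 j)
    linarith
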